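/- arXiv:1710.00204 — 6 statements merged into one kernel-verified Lean document; each statement's English description precedes it below -/
import Mathlib

section
/- Assume precision is monotonic with respect to similarity on D. Let 0 ≤ v⁻ ≤ u < v⁺ ≤ 1 be thresholds such that D₊ = {d ∈ D : sim(d) > v⁺} is nonempty and the set I of pairs of D with similarity in the interval (u, v⁺] is nonempty, and let m_H be the number of matching pairs in D_H = {d ∈ D : v⁻ ≤ sim(d) ≤ v⁺}. If α ∈ [0,1] and R(I) ≥ (α·|D₊| − (1−α)·m_H)/|D₊|, then the precision of the HUMO solution with bounds (v⁻, v⁺) is at least α. -/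
open Finset
open scoped Classical

variable {ι : Type*}

/-- Match proportion R(S) of a finite set of pairs: matching pairs divided by |S|. -/
noncomputable def matchProp (isMatch : ι → Prop) (S : Finset ι) : ℝ :=
  ((S.filter isMatch).card : ℝ) / (S.card : ℝ)

/-- D₋ : pairs with similarity below the lower threshold, machine-labeled unmatch. -/
noncomputable def Dminus (D : Finset ι) (sim : ι → ℝ) (vm : ℝ) : Finset ι :=
  D.filter (fun d => sim d < vm)

/-- D_H : pairs with similarity in [v⁻, v⁺], labeled correctly by the human. -/
noncomputable def DH (D : Finset ι) (sim : ι → ℝ) (vm vp : ℝ) : Finset ι :=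
  D.filter (fun d => vm ≤ sim d ∧ sim d ≤ vp)

/-- D₊ : pairs with similarity above the upper threshold, machine-labeled match. -/
noncomputable def Dplus (D : Finset ι) (sim : ι → ℝ) (vp : ℝ) : Finset ι :=
  D.filter (fun d => vp < sim d)

/-- The pairs labeled match by the HUMO solution with bounds (v⁻, v⁺):
    D₊ together with the matching pairs of D_H. -/
noncomputable def labeledMatch (D : Finset ι) (sim : ι → ℝ) (isMatch : ι → Prop)
    (vm vp : ℝ) : Finset ι :=
  Dplus D sim vp ∪ (DH D sim vm vp).filter isMatch

/-- Precision of the HUMO solution: fraction of matching pairs among pairs labeled match. -/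
noncomputable def humoPrecision (D : Finset ι) (sim : ι → ℝ) (isMatch : ι → Prop)
    (vm vp : ℝ) : ℝ :=
  (((labeledMatch D sim isMatch vm vp).filter isMatch).card : ℝ) /
    ((labeledMatch D sim isMatch vm vp).card : ℝ)

/-- Recall of the HUMO solution: fraction of matching pairs labeled match among all
    matching pairs of D. -/
noncomputable def humoRecall (D : Finset ι) (sim : ι → ℝ) (isMatch : ι → Prop)
    (vm vp : ℝ) : ℝ :=
  (((labeledMatch D sim isMatch vm vp).filter isMatch).card : ℝ) /
    ((D.filter isMatch).card : ℝ)

/-- Monotonicity of precision w.r.t. similarity: for any two intervals I, J ⊆ [0,1] with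
    every value of I less than every value of J, and both corresponding subsets of D
    nonempty, the match proportion over I is at most that over J. -/
def MonoPrecision (D : Finset ι) (sim : ι → ℝ) (isMatch : ι → Prop) : Prop :=
  ∀ I J : Set ℝ, I ⊆ Set.Icc 0 1 → J ⊆ Set.Icc 0 1 →
    I.OrdConnected → J.OrdConnected →
    (∀ x ∈ I, ∀ y ∈ J, x < y) →
    (D.filter (fun d => sim d ∈ I)).Nonempty →
    (D.filter (fun d => sim d ∈ J)).Nonempty →
    matchProp isMatch (D.filter (fun d => sim d ∈ I)) ≤
      matchProp isMatch (D.filter (fun d => sim d ∈ J))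

/-- Under monotonicity of precision, if the observed match proportion of the
    interval I = (u, v⁺] reaches the threshold (α·|D₊| − (1−α)·m_H)/|D₊| of Eq. 7, then the
    precision of the HUMO solution with bounds (v⁻, v⁺) is at least α. -/
theorem humo_baseline_precision
    (D : Finset ι) (sim : ι → ℝ) (isMatch : ι → Prop)
    (hsim : ∀ d ∈ D, sim d ∈ Set.Icc (0 : ℝ) 1)
    (hmono : MonoPrecision D sim isMatch)
    (vm u vp α : ℝ)
    (h0 : 0 ≤ vm) (h1 : vm ≤ u) (h2 : u < vp) (h3 : vp ≤ 1)
    (hα : α ∈ Set.Icc (0 : ℝ) 1)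
    (hDp : (Dplus D sim vp).Nonempty)
    (hI : (D.filter (fun d => u < sim d ∧ sim d ≤ vp)).Nonempty)
    (hcond : (α * ((Dplus D sim vp).card : ℝ) -
        (1 - α) * (((DH D sim vm vp).filter isMatch).card : ℝ)) /
          ((Dplus D sim vp).card : ℝ) ≤
        matchProp isMatch (D.filter (fun d => u < sim d ∧ sim d ≤ vp))) :
    α ≤ humoPrecision D sim isMatch vm vp := by
  have hm := hmono (Set.Ioc u vp) (Set.Ioc vp 1)
    (fun x hx => ⟨by linarith [hx.1], by linarith [hx.2]⟩)
    (fun x hx => ⟨by linarith [hx.1], hx.2⟩)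
    Set.ordConnected_Ioc Set.ordConnected_Ioc
    (fun x hx y hy => lt_of_le_of_lt hx.2 hy.1)
  have eI : ∀ inst, @Finset.filter _ (fun d => sim d ∈ Set.Ioc u vp) inst D
      = D.filter (fun d => u < sim d ∧ sim d ≤ vp) := by
    intro _; ext d; simp
  have eJ : ∀ inst, @Finset.filter _ (fun d => sim d ∈ Set.Ioc vp 1) inst D = Dplus D sim vp := by
    intro _; ext d
    simp only [Dplus, Finset.mem_filter, Set.mem_Ioc]
    constructor
    · rintro ⟨a, b, _⟩
      exact ⟨a, b⟩
    · rintro ⟨a, b⟩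
      exact ⟨a, b, (hsim d a).2⟩
  rw [eI, eJ] at hm
  have hR := hcond.trans (hm hI hDp)
  have hdisj : Disjoint (Dplus D sim vp) ((DH D sim vm vp).filter isMatch) := by
    rw [Finset.disjoint_left]
    intro d hd hd2
    simp only [Dplus, DH, Finset.mem_filter] at hd hd2
    linarith [hd.2, hd2.1.2.2]
  have c1 : (labeledMatch D sim isMatch vm vp).card
      = (Dplus D sim vp).card + ((DH D sim vm vp).filter isMatch).card :=
    Finset.card_union_of_disjoint hdisj
  have c2 : ((labeledMatch D sim isMatch vm vp).filter isMatch).card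
      = ((Dplus D sim vp).filter isMatch).card + ((DH D sim vm vp).filter isMatch).card := by
    unfold labeledMatch
    rw [Finset.filter_union, Finset.filter_filter isMatch isMatch]
    simp only [and_self]
    exact Finset.card_union_of_disjoint (hdisj.mono_left (Finset.filter_subset _ _))
  have hpos : (0 : ℝ) < ((Dplus D sim vp).card : ℝ) := by
    exact_mod_cast hDp.card_pos
  unfold matchProp at hR
  rw [div_le_div_iff_of_pos_right hpos] at hR
  unfold humoPrecision
  rw [c1, c2]
  push_cast
  rw [le_div_iff₀ (by positivity)]
  linarith
end

section
/- Assume precision is monotonic with respect to similarity on D. Let 0 ≤ v⁻ ≤ u < v⁺ ≤ 1 and v⁻ < w ≤ v⁺ be thresholds such that D₋ = {d ∈ D : sim(d) < v⁻} and D₊ = {d ∈ D : sim(d) > v⁺} are nonempty, the set I⁺ of pairs of D with similarity in (u, v⁺] is nonempty, and the set I⁻ of pairs of D with similarity in [v⁻, w) is nonempty. Let m_H be the number of matching pairs in D_H = {d ∈ D : v⁻ ≤ sim(d) ≤ v⁺} and set M₀ = m_H + |D₊|·R(I⁺); assume M₀ > 0. If β ∈ (0,1] and R(I⁻) ≤ (1−β)·M₀/(β·|D₋|),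 then the recall of the HUMO solution with bounds (v⁻, v⁺) is at least β. -/
open Finset
open scoped Classical

variable {ι : Type*}

/-- Under monotonicity of precision, if the observed match proportion of the
    interval I⁻ = [v⁻, w) is below the threshold (1−β)·M₀/(β·|D₋|) of Eq. 9, where
    M₀ = m_H + |D₊|·R(I⁺) > 0 with I⁺ = (u, v⁺], then the recall of the HUMO solution with
    bounds (v⁻, v⁺) is at least β. -/
theorem humo_baseline_recall
    (D : Finset ι) (sim : ι → ℝ) (isMatch : ι → Prop)
    (hsim : ∀ d ∈ D, sim d ∈ Set.Icc (0 : ℝ) 1)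
    (hmono : MonoPrecision D sim isMatch)
    (vm u w vp β : ℝ)
    (h0 : 0 ≤ vm) (h1 : vm ≤ u) (h2 : u < vp) (h3 : vp ≤ 1)
    (h4 : vm < w) (h5 : w ≤ vp)
    (hβ : β ∈ Set.Ioc (0 : ℝ) 1)
    (hDm : (Dminus D sim vm).Nonempty)
    (hDp : (Dplus D sim vp).Nonempty)
    (hIp : (D.filter (fun d => u < sim d ∧ sim d ≤ vp)).Nonempty)
    (hIm : (D.filter (fun d => vm ≤ sim d ∧ sim d < w)).Nonempty)
    (hM0 : 0 < (((DH D sim vm vp).filter isMatch).card : ℝ) +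
        ((Dplus D sim vp).card : ℝ) *
          matchProp isMatch (D.filter (fun d => u < sim d ∧ sim d ≤ vp)))
    (hcond : matchProp isMatch (D.filter (fun d => vm ≤ sim d ∧ sim d < w)) ≤
        (1 - β) * ((((DH D sim vm vp).filter isMatch).card : ℝ) +
            ((Dplus D sim vp).card : ℝ) *
              matchProp isMatch (D.filter (fun d => u < sim d ∧ sim d ≤ vp))) /
          (β * ((Dminus D sim vm).card : ℝ))) :
    β ≤ humoRecall D sim isMatch vm vp := by
  have key : ∀ I J : Set ℝ, ∀ S T : Finset ι, I ⊆ Set.Icc 0 1 → J ⊆ Set.Icc 0 1 →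
      I.OrdConnected → J.OrdConnected → (∀ x ∈ I, ∀ y ∈ J, x < y) →
      (∀ d, d ∈ S ↔ d ∈ D ∧ sim d ∈ I) → (∀ d, d ∈ T ↔ d ∈ D ∧ sim d ∈ J) →
      S.Nonempty → T.Nonempty → matchProp isMatch S ≤ matchProp isMatch T := by
    intro I J S T hI hJ oI oJ hlt hS hT nS nT
    have eS : S = D.filter (fun d => sim d ∈ I) := by
      ext d; rw [hS, Finset.mem_filter]
    have eT : T = D.filter (fun d => sim d ∈ J) := by
      ext d; rw [hT, Finset.mem_filter]
    subst eS
    subst eT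
    exact hmono I J hI hJ oI oJ hlt nS nT
  have k1 := key (Set.Ico 0 vm) (Set.Ico vm w) (Dminus D sim vm)
    (D.filter (fun d => vm ≤ sim d ∧ sim d < w))
    (fun x hx => ⟨hx.1, by linarith [hx.2]⟩)
    (fun x hx => ⟨by linarith [hx.1], by linarith [hx.2]⟩)
    Set.ordConnected_Ico Set.ordConnected_Ico
    (fun x hx y hy => lt_of_lt_of_le hx.2 hy.1)
    (by
      intro d
      simp only [Dminus, Finset.mem_filter, Set.mem_Ico]
      exact ⟨fun h => ⟨h.1, (hsim d h.1).1, h.2⟩, fun h => ⟨h.1, h.2.2⟩⟩)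
    (by intro d; simp only [Finset.mem_filter, Set.mem_Ico])
    hDm hIm
  have k2 := key (Set.Ioc u vp) (Set.Ioc vp 1)
    (D.filter (fun d => u < sim d ∧ sim d ≤ vp)) (Dplus D sim vp)
    (fun x hx => ⟨by linarith [hx.1], by linarith [hx.2]⟩)
    (fun x hx => ⟨by linarith [hx.1], hx.2⟩)
    Set.ordConnected_Ioc Set.ordConnected_Ioc
    (fun x hx y hy => lt_of_le_of_lt hx.2 hy.1)
    (by intro d; simp only [Finset.mem_filter, Set.mem_Ioc])
    (by
      intro d
      simp only [Dplus, Finset.mem_filter, Set.mem_Ioc]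
      exact ⟨fun h => ⟨h.1, h.2, (hsim d h.1).2⟩, fun h => ⟨h.1, h.2.1⟩⟩)
    hIp hDp
  have cm : (0 : ℝ) < ((Dminus D sim vm).card : ℝ) := by exact_mod_cast hDm.card_pos
  have cp : (0 : ℝ) < ((Dplus D sim vp).card : ℝ) := by exact_mod_cast hDp.card_pos
  have e1 : (labeledMatch D sim isMatch vm vp).filter isMatch =
      (Dplus D sim vp).filter isMatch ∪ (DH D sim vm vp).filter isMatch := by
    ext d
    simp only [labeledMatch, Finset.mem_filter, Finset.mem_union]
    tauto
  have e2 : D.filter isMatch = (Dminus D sim vm).filter isMatch ∪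
      (labeledMatch D sim isMatch vm vp).filter isMatch := by
    rw [e1]
    ext d
    simp only [Dplus, DH, Dminus, Finset.mem_filter, Finset.mem_union]
    have := lt_or_ge (sim d) vm
    have := lt_or_ge vp (sim d)
    tauto
  have c1 : ((labeledMatch D sim isMatch vm vp).filter isMatch).card =
      ((Dplus D sim vp).filter isMatch).card + ((DH D sim vm vp).filter isMatch).card := by
    rw [e1, Finset.card_union_of_disjoint]
    rw [Finset.disjoint_left]
    intro d hd hd'
    simp only [Dplus, DH, Finset.mem_filter] at hd hd'
    linarith [hd.1.2, hd'.1.2.2]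
  have c2 : (D.filter isMatch).card = ((Dminus D sim vm).filter isMatch).card +
      ((labeledMatch D sim isMatch vm vp).filter isMatch).card := by
    rw [e2, Finset.card_union_of_disjoint]
    rw [e1, Finset.disjoint_left]
    intro d hd hd'
    simp only [Dplus, DH, Dminus, Finset.mem_filter, Finset.mem_union] at hd hd'
    rcases hd' with hd' | hd'
    · linarith [hd.1.2, hd'.1.2]
    · linarith [hd.1.2, hd'.1.2.1]
  unfold humoRecall
  rw [c2, c1]
  push_cast
  generalize matchProp isMatch (D.filter (fun d => u < sim d ∧ sim d ≤ vp)) = rp at *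
  generalize matchProp isMatch (D.filter (fun d => vm ≤ sim d ∧ sim d < w)) = rm at *
  unfold matchProp at k1 k2
  rw [div_le_iff₀ cm] at k1
  rw [le_div_iff₀ cp] at k2
  obtain ⟨b0, b1⟩ := hβ
  rw [le_div_iff₀ (mul_pos b0 cm)] at hcond
  have a0 : (0 : ℝ) ≤ (((Dminus D sim vm).filter isMatch).card : ℝ) := Nat.cast_nonneg _
  generalize (((Dminus D sim vm).filter isMatch).card : ℝ) = a at *
  generalize (((Dplus D sim vp).filter isMatch).card : ℝ) = p at *
  generalize (((DH D sim vm vp).filter isMatch).card : ℝ) = h at *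
  generalize ((Dminus D sim vm).card : ℝ) = nm at *
  generalize ((Dplus D sim vp).card : ℝ) = np at *
  rw [le_div_iff₀ (by linarith)]
  have t1 := mul_le_mul_of_nonneg_left k1 b0.le
  have t2 := mul_le_mul_of_nonneg_left k2 (sub_nonneg.2 b1)
  linarith
end

section
/- (Theorem 1 of the paper.) Assume precision is monotonic with respect to similarity on D. Let 0 ≤ v⁻ ≤ u < v⁺ ≤ 1 and v⁻ < w ≤ v⁺ be thresholds such that D₋ = {d ∈ D : sim(d) < v⁻} and D₊ = {d ∈ D : sim(d) > v⁺} are nonempty, the set I⁺ of pairs of D with similarity in (u, v⁺] is nonempty, and the set I⁻ of pairs of D with similarity in [v⁻, w) is nonempty. Let m_H be the number of matching pairs in D_H = {d ∈ D : v⁻ ≤ sim(d) ≤ v⁺}. Let α ∈ [0,1] and β ∈ (0,1], and assume m_H + |D₊|·R(I⁺) > 0. If R(I⁺) ≥ (α·|D₊| − (1−α)·m_H)/|D₊| and R(I⁻) ≤ (1−β)·(m_H + |D₊|·R(I⁺))/(β·|D₋|), then the HUMO solution with bounds (v⁻, v⁺) achieves precision at least α and recall at least β. -/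
open Finset
open scoped Classical

variable {ι : Type*}

/-- Theorem 1 of the paper: under monotonicity of precision, if the observed
    match proportion of I⁺ = (u, v⁺] reaches the precision threshold of Eq. 7 and the
    observed match proportion of I⁻ = [v⁻, w) is below the recall threshold of Eq. 9, then
    the HUMO solution with bounds (v⁻, v⁺) achieves precision ≥ α and recall ≥ β. -/
theorem humo_baseline_quality_guarantee
    (D : Finset ι) (sim : ι → ℝ) (isMatch : ι → Prop)
    (hsim : ∀ d ∈ D, sim d ∈ Set.Icc (0 : ℝ) 1)
    (hmono : MonoPrecision D sim isMatch)
    (vm u w vp α β : ℝ)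
    (h0 : 0 ≤ vm) (h1 : vm ≤ u) (h2 : u < vp) (h3 : vp ≤ 1)
    (h4 : vm < w) (h5 : w ≤ vp)
    (hα : α ∈ Set.Icc (0 : ℝ) 1) (hβ : β ∈ Set.Ioc (0 : ℝ) 1)
    (hDm : (Dminus D sim vm).Nonempty)
    (hDp : (Dplus D sim vp).Nonempty)
    (hIp : (D.filter (fun d => u < sim d ∧ sim d ≤ vp)).Nonempty)
    (hIm : (D.filter (fun d => vm ≤ sim d ∧ sim d < w)).Nonempty)
    (hM0 : 0 < (((DH D sim vm vp).filter isMatch).card : ℝ) +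
        ((Dplus D sim vp).card : ℝ) *
          matchProp isMatch (D.filter (fun d => u < sim d ∧ sim d ≤ vp)))
    (hcondP : (α * ((Dplus D sim vp).card : ℝ) -
        (1 - α) * (((DH D sim vm vp).filter isMatch).card : ℝ)) /
          ((Dplus D sim vp).card : ℝ) ≤
        matchProp isMatch (D.filter (fun d => u < sim d ∧ sim d ≤ vp)))
    (hcondR : matchProp isMatch (D.filter (fun d => vm ≤ sim d ∧ sim d < w)) ≤
        (1 - β) * ((((DH D sim vm vp).filter isMatch).card : ℝ) +
            ((Dplus D sim vp).card : ℝ) *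
              matchProp isMatch (D.filter (fun d => u < sim d ∧ sim d ≤ vp))) /
          (β * ((Dminus D sim vm).card : ℝ))) :
    α ≤ humoPrecision D sim isMatch vm vp ∧ β ≤ humoRecall D sim isMatch vm vp := by
  have hP : matchProp isMatch (D.filter (fun d => u < sim d ∧ sim d ≤ vp)) ≤
      matchProp isMatch (Dplus D sim vp) := by
    have e1 : @Finset.filter _ (fun d => sim d ∈ Set.Ioc u vp) (fun _ => Classical.propDecidable _) D =
        D.filter (fun d => u < sim d ∧ sim d ≤ vp) := by
      ext d; simp
    have e2 : @Finset.filter _ (fun d => sim d ∈ Set.Ioc vp 1) (fun _ => Classical.propDecidable _) D = Dplus D sim vp := by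
      ext d
      simp only [Dplus, Finset.mem_filter, Set.mem_Ioc]
      exact ⟨fun h => ⟨h.1, h.2.1⟩, fun h => ⟨h.1, h.2, (hsim d h.1).2⟩⟩
    have := hmono (Set.Ioc u vp) (Set.Ioc vp 1)
      (fun x hx => ⟨by linarith [hx.1], by linarith [hx.2]⟩)
      (fun x hx => ⟨by linarith [hx.1], hx.2⟩)
      Set.ordConnected_Ioc Set.ordConnected_Ioc
      (fun x hx y hy => lt_of_le_of_lt hx.2 hy.1)
      (by rw [e1]; exact hIp) (by rw [e2]; exact hDp)
    rwa [e1, e2] at this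
  have hN : matchProp isMatch (Dminus D sim vm) ≤
      matchProp isMatch (D.filter (fun d => vm ≤ sim d ∧ sim d < w)) := by
    have e1 : @Finset.filter _ (fun d => sim d ∈ Set.Ico vm w) (fun _ => Classical.propDecidable _) D =
        D.filter (fun d => vm ≤ sim d ∧ sim d < w) := by
      ext d; simp
    have e2 : @Finset.filter _ (fun d => sim d ∈ Set.Ico 0 vm) (fun _ => Classical.propDecidable _) D = Dminus D sim vm := by
      ext d
      simp only [Dminus, Finset.mem_filter, Set.mem_Ico]
      exact ⟨fun h => ⟨h.1, h.2.2⟩, fun h => ⟨h.1, (hsim d h.1).1, h.2⟩⟩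
    have := hmono (Set.Ico 0 vm) (Set.Ico vm w)
      (fun x hx => ⟨hx.1, by linarith [hx.2]⟩)
      (fun x hx => ⟨by linarith [hx.1], by linarith [hx.2]⟩)
      Set.ordConnected_Ico Set.ordConnected_Ico
      (fun x hx y hy => lt_of_lt_of_le hx.2 hy.1)
      (by rw [e2]; exact hDm) (by rw [e1]; exact hIm)
    rwa [e1, e2] at this
  have c1 : (labeledMatch D sim isMatch vm vp).card =
      (Dplus D sim vp).card + ((DH D sim vm vp).filter isMatch).card := by
    unfold labeledMatch
    apply Finset.card_union_of_disjoint
    rw [Finset.disjoint_left]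
    intro d hd hd'
    simp only [Dplus, DH, Finset.mem_filter] at hd hd'
    linarith [hd.2, hd'.1.2.2]
  have c2 : ((labeledMatch D sim isMatch vm vp).filter isMatch).card =
      ((Dplus D sim vp).filter isMatch).card + ((DH D sim vm vp).filter isMatch).card := by
    have : (labeledMatch D sim isMatch vm vp).filter isMatch =
        (Dplus D sim vp).filter isMatch ∪ (DH D sim vm vp).filter isMatch := by
      ext d
      simp only [labeledMatch, Finset.mem_filter, Finset.mem_union]
      tauto
    rw [this]
    apply Finset.card_union_of_disjoint
    rw [Finset.disjoint_left]
    intro d hd hd'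
    simp only [Dplus, DH, Finset.mem_filter] at hd hd'
    linarith [hd.1.2, hd'.1.2.2]
  have c3 : (D.filter isMatch).card = ((Dminus D sim vm).filter isMatch).card +
      ((labeledMatch D sim isMatch vm vp).filter isMatch).card := by
    have : D.filter isMatch = (Dminus D sim vm).filter isMatch ∪
        (labeledMatch D sim isMatch vm vp).filter isMatch := by
      ext d
      simp only [labeledMatch, Dminus, Dplus, DH, Finset.mem_filter, Finset.mem_union]
      have := lt_or_ge (sim d) vm
      have := lt_or_ge vp (sim d)
      tauto
    rw [this]
    apply Finset.card_union_of_disjoint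
    rw [Finset.disjoint_left]
    intro d hd hd'
    simp only [labeledMatch, Dminus, Dplus, DH, Finset.mem_filter, Finset.mem_union] at hd hd'
    rcases hd'.1 with h | h
    · linarith [hd.1.2, h.2]
    · linarith [hd.1.2, h.1.2.1]
  have hp : (0 : ℝ) < (Dplus D sim vp).card := by exact_mod_cast hDp.card_pos
  have hm : (0 : ℝ) < (Dminus D sim vm).card := by exact_mod_cast hDm.card_pos
  unfold humoPrecision humoRecall
  rw [c3, c1, c2]
  push_cast
  have hN' := hN.trans hcondR
  unfold matchProp at hP hN'
  change _ / _ ≤ matchProp _ _ at hcondP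
  unfold matchProp at hcondP hM0
  generalize (((D.filter (fun d => u < sim d ∧ sim d ≤ vp)).filter isMatch).card : ℝ) /
    ((D.filter (fun d => u < sim d ∧ sim d ≤ vp)).card : ℝ) = R at *
  have n1 : (0 : ℝ) ≤ ((DH D sim vm vp).filter isMatch).card := Nat.cast_nonneg _
  have n2 : (0 : ℝ) ≤ ((Dminus D sim vm).filter isMatch).card := Nat.cast_nonneg _
  generalize (((DH D sim vm vp).filter isMatch).card : ℝ) = mH at *
  generalize (((Dminus D sim vm).filter isMatch).card : ℝ) = mm at *
  generalize (((Dplus D sim vp).filter isMatch).card : ℝ) = mp at *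
  generalize ((Dplus D sim vp).card : ℝ) = p at *
  generalize ((Dminus D sim vm).card : ℝ) = m at *
  obtain ⟨hb0, hb1⟩ := hβ
  rw [le_div_iff₀ hp] at hP
  rw [div_le_iff₀ hp] at hcondP
  rw [div_le_div_iff₀ hm (by positivity)] at hN'
  have hR : mm * β ≤ (1 - β) * (mH + p * R) := by
    have : (mm * β) * m ≤ ((1 - β) * (mH + p * R)) * m := by linarith
    exact le_of_mul_le_mul_right this hm
  have hR2 : (1 - β) * (mH + p * R) ≤ (1 - β) * (mH + mp) :=
    mul_le_mul_of_nonneg_left (by linarith) (by linarith)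
  constructor
  · rw [le_div_iff₀ (by linarith)]
    linarith
  · rw [le_div_iff₀ (by linarith)]
    linarith
end

section
/- Fix an upper threshold v⁺ ∈ [0,1] and let 0 ≤ v₁⁻ ≤ v₂⁻ ≤ v⁺. If the set of pairs labeled match by the HUMO solution with bounds (v₂⁻, v⁺) is nonempty, then the precision of the HUMO solution with bounds (v₁⁻, v⁺) is at least the precision of the HUMO solution with bounds (v₂⁻, v⁺); that is, moving the lower bound of the human region to a lower value can only increase the achieved precision. -/
open Finset
open scoped Classical

variable {ι : Type*}

/-- with the upper threshold v⁺ fixed and 0 ≤ v₁⁻ ≤ v₂⁻ ≤ v⁺, if the set of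
    pairs labeled match with bounds (v₂⁻, v⁺) is nonempty, then moving the lower bound of
    the human region down from v₂⁻ to v₁⁻ can only increase the achieved precision. -/
theorem humo_moving_lower_bound_precision
    (D : Finset ι) (sim : ι → ℝ) (isMatch : ι → Prop)
    (hsim : ∀ d ∈ D, sim d ∈ Set.Icc (0 : ℝ) 1)
    (vp vm1 vm2 : ℝ)
    (h0 : 0 ≤ vm1) (h1 : vm1 ≤ vm2) (h2 : vm2 ≤ vp) (h3 : vp ≤ 1)
    (hne : (labeledMatch D sim isMatch vm2 vp).Nonempty) :
    humoPrecision D sim isMatch vm2 vp ≤ humoPrecision D sim isMatch vm1 vp := by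
  have hu : (labeledMatch D sim isMatch vm1 vp).filter (fun d => ¬ isMatch d)
      = (labeledMatch D sim isMatch vm2 vp).filter (fun d => ¬ isMatch d) := by
    ext d
    simp only [labeledMatch, Dplus, DH, Finset.mem_filter, Finset.mem_union]
    tauto
  have hsub : labeledMatch D sim isMatch vm2 vp ⊆ labeledMatch D sim isMatch vm1 vp := by
    intro d hd
    simp only [labeledMatch, Dplus, DH, Finset.mem_filter, Finset.mem_union] at hd ⊢
    rcases hd with hd | ⟨⟨hD, ha, hb⟩, hm⟩
    · exact Or.inl hd
    · exact Or.inr ⟨⟨hD, h1.trans ha, hb⟩, hm⟩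
  have hm := Finset.card_le_card (Finset.filter_subset_filter isMatch hsub)
  have e1 := Finset.card_filter_add_card_filter_not (s := labeledMatch D sim isMatch vm1 vp) isMatch
  have e2 := Finset.card_filter_add_card_filter_not (s := labeledMatch D sim isMatch vm2 vp) isMatch
  rw [hu] at e1
  have p2 := hne.card_pos
  have p1 := (hne.mono hsub).card_pos
  unfold humoPrecision
  rw [div_le_div_iff₀ (by exact_mod_cast p2) (by exact_mod_cast p1)]
  norm_cast
  rw [← e1, ← e2]
  nlinarith [Nat.mul_le_mul_right (((labeledMatch D sim isMatch vm2 vp).filter (fun d => ¬ isMatch d)).card) hm]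
end

section
/- (Recall half of Theorem 2 of the paper, abstract form.) Let (Ω, 𝒜, P) be a probability space and let X and Y be real-valued random variables with X ≥ 0 and Y ≥ 0 almost surely. Let L > 0 and U ≥ 0 be reals, let θ ∈ [0,1], and let β ∈ [0,1] satisfy β ≤ L/(U+L). If the events {X ≥ L} and {Y ≤ U} are independent and each has probability at least √θ, then P(X/(X+Y) ≥ β) ≥ θ. -/
open MeasureTheory ProbabilityTheory

/-- recall half of Theorem 2 of the paper, abstract form: if X, Y ≥ 0 a.s.,
    L > 0, U ≥ 0, β ≤ L/(U+L), and the independent events {X ≥ L} and {Y ≤ U} each have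
    probability at least √θ, then the recall X/(X+Y) is at least β with probability ≥ θ. -/
theorem allSampling_recall_guarantee
    {Ω : Type*} [MeasurableSpace Ω] (P : Measure Ω) [IsProbabilityMeasure P]
    (X Y : Ω → ℝ)
    (hX : ∀ᵐ ω ∂P, 0 ≤ X ω) (hY : ∀ᵐ ω ∂P, 0 ≤ Y ω)
    (L U θ β : ℝ) (hL : 0 < L) (hU : 0 ≤ U)
    (hθ : θ ∈ Set.Icc (0 : ℝ) 1) (hβ : β ∈ Set.Icc (0 : ℝ) 1)
    (hβle : β ≤ L / (U + L))
    (hind : IndepSet {ω | L ≤ X ω} {ω | Y ω ≤ U} P)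
    (hPX : Real.sqrt θ ≤ (P {ω | L ≤ X ω}).toReal)
    (hPY : Real.sqrt θ ≤ (P {ω | Y ω ≤ U}).toReal) :
    θ ≤ (P {ω | β ≤ X ω / (X ω + Y ω)}).toReal := by
  have hmul : P ({ω | L ≤ X ω} ∩ {ω | Y ω ≤ U}) = P {ω | L ≤ X ω} * P {ω | Y ω ≤ U} := by
    rw [IndepSet_iff_Indep, Indep_iff] at hind
    exact hind _ _ (MeasurableSpace.measurableSet_generateFrom rfl)
      (MeasurableSpace.measurableSet_generateFrom rfl)
  have hle : P ({ω | L ≤ X ω} ∩ {ω | Y ω ≤ U}) ≤ P {ω | β ≤ X ω / (X ω + Y ω)} := by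
    apply measure_mono_ae
    filter_upwards [hY] with ω hy h
    obtain ⟨h1, h2⟩ := h
    have h1' : L ≤ X ω := h1
    have h2' : Y ω ≤ U := h2
    change β ≤ X ω / (X ω + Y ω)
    refine hβle.trans ?_
    rw [div_le_div_iff₀ (by linarith) (by linarith)]
    nlinarith [mul_le_mul h1' h2' hy (hL.le.trans h1')]
  have h3 := ENNReal.toReal_mono (measure_ne_top P _) hle
  rw [hmul, ENNReal.toReal_mul] at h3
  have h4 := mul_le_mul hPX hPY (Real.sqrt_nonneg θ) ENNReal.toReal_nonneg
  rw [Real.mul_self_sqrt hθ.1] at h4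
  exact h4.trans h3
end

section
/- (Precision half of Theorem 2 of the paper, abstract form.) Let (Ω, 𝒜, P) be a probability space, let N ≥ 0 be a real constant, and let X and Y be real-valued random variables with, almost surely, X ≥ 0 and 0 ≤ Y ≤ N. Let a ≥ 0 and b ≥ 0 be reals with a + N > 0, let θ ∈ [0,1], and let α ∈ [0,1] satisfy α ≤ (a+b)/(a+N). If the events {X ≥ a} and {Y ≥ b} are independent and each has probability at least √θ, then P((X+Y)/(X+N) ≥ α) ≥ θ. -/
open MeasureTheory ProbabilityTheory

/-- precision half of Theorem 2 of the paper, abstract form: if X ≥ 0 and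
    0 ≤ Y ≤ N a.s., a, b ≥ 0 with a + N > 0, α ≤ (a+b)/(a+N), and the independent events
    {X ≥ a} and {Y ≥ b} each have probability at least √θ, then the precision
    (X+Y)/(X+N) is at least α with probability ≥ θ. -/
theorem allSampling_precision_guarantee
    {Ω : Type*} [MeasurableSpace Ω] (P : Measure Ω) [IsProbabilityMeasure P]
    (N : ℝ) (hN : 0 ≤ N) (X Y : Ω → ℝ)
    (hX : ∀ᵐ ω ∂P, 0 ≤ X ω) (hY : ∀ᵐ ω ∂P, 0 ≤ Y ω ∧ Y ω ≤ N)
    (a b θ α : ℝ) (ha : 0 ≤ a) (hb : 0 ≤ b) (haN : 0 < a + N)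
    (hθ : θ ∈ Set.Icc (0 : ℝ) 1) (hα : α ∈ Set.Icc (0 : ℝ) 1)
    (hαle : α ≤ (a + b) / (a + N))
    (hind : IndepSet {ω | a ≤ X ω} {ω | b ≤ Y ω} P)
    (hPX : Real.sqrt θ ≤ (P {ω | a ≤ X ω}).toReal)
    (hPY : Real.sqrt θ ≤ (P {ω | b ≤ Y ω}).toReal) :
    θ ≤ (P {ω | α ≤ (X ω + Y ω) / (X ω + N)}).toReal := by
  have hinter : P ({ω | a ≤ X ω} ∩ {ω | b ≤ Y ω}) = P {ω | a ≤ X ω} * P {ω | b ≤ Y ω} :=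
    (Indep_iff _ _ P).1 hind _ _
      (MeasurableSpace.measurableSet_generateFrom (Set.mem_singleton _))
      (MeasurableSpace.measurableSet_generateFrom (Set.mem_singleton _))
  have hsub : {ω | a ≤ X ω} ∩ {ω | b ≤ Y ω} ⊆ {ω | α ≤ (X ω + Y ω) / (X ω + N)} := by
    rintro ω ⟨h1, h2⟩
    simp only [Set.mem_setOf_eq] at h1 h2 ⊢
    rw [le_div_iff₀ haN] at hαle
    rw [le_div_iff₀ (by linarith)]
    nlinarith [mul_nonneg (sub_nonneg.2 hα.2) (sub_nonneg.2 h1)]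
  calc θ = Real.sqrt θ * Real.sqrt θ := (Real.mul_self_sqrt hθ.1).symm
    _ ≤ (P {ω | a ≤ X ω}).toReal * (P {ω | b ≤ Y ω}).toReal :=
      mul_le_mul hPX hPY (Real.sqrt_nonneg _) ENNReal.toReal_nonneg
    _ = (P ({ω | a ≤ X ω} ∩ {ω | b ≤ Y ω})).toReal := by rw [hinter, ENNReal.toReal_mul]
    _ ≤ _ := ENNReal.toReal_mono (measure_ne_top _ _) (measure_mono hsub)
end
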